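/- Let u₀ : ℝ → ℝ be bounded, uniformly continuous and odd (u₀(-x) = -u₀(x)). Let u ∈ C([0,∞), C_ub(ℝ)) be a mild solution of the modular Burgers' equation, i.e. u(t,·) = e^{∂ₓ²t}u₀ + ∂ₓ ∫₀ᵗ e^{∂ₓ²(t-s)}|u(s,·)| ds. Then u(t,-x) = -u(t,x) for every t ≥ 0 and x ∈ ℝ. -/

import Mathlib

open MeasureTheory Set

/-- The heat kernel on the real line. -/
noncomputable def heatKernel (t x : ℝ) : ℝ :=
  (Real.sqrt (4 * Real.pi * t))⁻¹ * Real.exp (-x ^ 2 / (4 * t))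

/-- The spatial derivative of the heat kernel. -/
noncomputable def heatKernelDeriv (t x : ℝ) : ℝ :=
  -(x / (2 * t)) * heatKernel t x

theorem heatKernel_neg (t x : ℝ) : heatKernel t (-x) = heatKernel t x := by
  simp [heatKernel]

theorem heatKernelDeriv_neg (t x : ℝ) : heatKernelDeriv t (-x) = -heatKernelDeriv t x := by
  simp only [heatKernelDeriv, heatKernel_neg]
  ring

theorem hasDerivAt_heatKernel (t x : ℝ) :
    HasDerivAt (heatKernel t) (heatKernelDeriv t x) x := by
  have h : HasDerivAt (fun x : ℝ => -x ^ 2 / (4 * t)) (-(2 * x) / (4 * t)) x := by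
    simpa using ((hasDerivAt_pow 2 x).neg.div_const (4 * t))
  refine (h.exp.const_mul (Real.sqrt (4 * Real.pi * t))⁻¹).congr_deriv ?_
  simp only [heatKernelDeriv, heatKernel]
  rw [show (-(2 * x) / (4 * t)) = -(x / (2 * t)) by
    rw [show 4 * t = 2 * (2 * t) by ring, neg_div, mul_div_mul_left _ _ two_ne_zero]]
  ring

theorem continuous_heatKernel (t : ℝ) : Continuous (heatKernel t) :=
  continuous_iff_continuousAt.2 fun x => (hasDerivAt_heatKernel t x).continuousAt

theorem continuous_heatKernelDeriv (t : ℝ) : Continuous (heatKernelDeriv t) :=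
  ((continuous_id.div_const _).neg).mul (continuous_heatKernel t)

theorem measurable_heatKernelDeriv : Measurable (Function.uncurry heatKernelDeriv) := by
  unfold heatKernelDeriv heatKernel Function.uncurry
  fun_prop

theorem heatKernel_eq (t x : ℝ) :
    heatKernel t x = (Real.sqrt (4 * Real.pi * t))⁻¹ * Real.exp (-(4 * t)⁻¹ * x ^ 2) := by
  unfold heatKernel
  congr 2
  ring

theorem integrable_heatKernel {t : ℝ} (ht : 0 < t) : Integrable (heatKernel t) := by
  rw [funext (heatKernel_eq t)]
  exact (integrable_exp_neg_mul_sq (by positivity)).const_mul _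

theorem abs_heatKernelDeriv {t : ℝ} (ht : 0 < t) (x : ℝ) :
    |heatKernelDeriv t x| = (2 * t)⁻¹ * (Real.sqrt (4 * Real.pi * t))⁻¹ *
      (|x| * Real.exp (-(4 * t)⁻¹ * x ^ 2)) := by
  rw [heatKernelDeriv, heatKernel_eq, abs_mul, abs_neg, abs_div,
    abs_of_pos (show 0 < 2 * t by positivity), abs_mul, Real.abs_exp, abs_inv,
    abs_of_nonneg (Real.sqrt_nonneg _)]
  ring

theorem integrable_heatKernelDeriv {t : ℝ} (ht : 0 < t) : Integrable (heatKernelDeriv t) := by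
  refine (((integrable_mul_exp_neg_mul_sq (b := (4 * t)⁻¹) (by positivity)).const_mul
    (-(2 * t)⁻¹ * (Real.sqrt (4 * Real.pi * t))⁻¹))).congr (.of_forall fun x => ?_)
  simp only [heatKernelDeriv, heatKernel_eq]
  ring

theorem integral_abs_mul_exp_neg_mul_sq {b : ℝ} (hb : 0 < b) :
    ∫ x : ℝ, |x| * Real.exp (-b * x ^ 2) = b⁻¹ := by
  have h := integral_comp_abs (f := fun x : ℝ => x * Real.exp (-b * x ^ 2))
  simp only [sq_abs] at h
  have h2 := integral_rpow_mul_exp_neg_mul_rpow (p := 2) (q := 1) (b := b)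
    (by norm_num) (by norm_num) hb
  norm_num [Real.rpow_neg_one] at h2
  simp only [neg_mul] at h ⊢
  rw [h, h2]
  ring

theorem integral_abs_heatKernelDeriv_le {t : ℝ} (ht : 0 < t) :
    ∫ x : ℝ, |heatKernelDeriv t x| ≤ t ^ (-(1 / 2) : ℝ) := by
  simp only [abs_heatKernelDeriv ht]
  rw [integral_const_mul, integral_abs_mul_exp_neg_mul_sq (by positivity), inv_inv,
    Real.rpow_neg ht.le, ← Real.sqrt_eq_rpow]
  have h : Real.sqrt (4 * Real.pi * t) = 2 * Real.sqrt Real.pi * Real.sqrt t := by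
    rw [Real.sqrt_mul (by positivity), Real.sqrt_mul (by positivity),
      show (4 : ℝ) = 2 ^ 2 by norm_num, Real.sqrt_sq (by norm_num)]
  have hpi : 1 ≤ Real.sqrt Real.pi := Real.one_le_sqrt.2 (by linarith [Real.pi_gt_three])
  have hs : 0 < Real.sqrt t := Real.sqrt_pos.2 ht
  rw [h]
  calc (2 * t)⁻¹ * (2 * Real.sqrt Real.pi * Real.sqrt t)⁻¹ * (4 * t)
      = (Real.sqrt Real.pi)⁻¹ * (Real.sqrt t)⁻¹ := by field_simp; norm_num
    _ ≤ 1 * (Real.sqrt t)⁻¹ := by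
        gcongr
        exact inv_le_one_of_one_le₀ hpi
    _ = (Real.sqrt t)⁻¹ := one_mul _

theorem integrable_heatKernelDeriv_mul {t : ℝ} (ht : 0 < t) {v : ℝ → ℝ} (hv : Continuous v)
    {A : ℝ} (hA : ∀ y, |v y| ≤ A) (x : ℝ) :
    Integrable fun y => heatKernelDeriv t (x - y) * v y :=
  ((integrable_heatKernelDeriv ht).comp_sub_left x).mul_bdd hv.aestronglyMeasurable
    (.of_forall hA)

theorem abs_integral_heatKernelDeriv_mul_le {t : ℝ} (ht : 0 < t) {v : ℝ → ℝ}
    {A : ℝ} (hA : ∀ y, |v y| ≤ A) (x : ℝ) :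
    |∫ y, heatKernelDeriv t (x - y) * v y| ≤ A * t ^ (-(1 / 2) : ℝ) := by
  have hA0 : 0 ≤ A := (abs_nonneg _).trans (hA 0)
  calc |∫ y, heatKernelDeriv t (x - y) * v y|
      ≤ ∫ y, A * |heatKernelDeriv t (x - y)| := by
        refine norm_integral_le_of_norm_le (f := fun y => heatKernelDeriv t (x - y) * v y)
          (((integrable_heatKernelDeriv ht).comp_sub_left x).abs.const_mul A)
          (.of_forall fun y => ?_)
        rw [Real.norm_eq_abs, abs_mul, mul_comm]
        gcongr
        exact hA y
    _ = A * ∫ y, |heatKernelDeriv t y| := by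
        rw [integral_const_mul,
          integral_sub_left_eq_self (fun y => |heatKernelDeriv t y|) volume x]
    _ ≤ _ := by
        gcongr
        exact integral_abs_heatKernelDeriv_le ht

theorem deriv_integral_heatKernel_mul {t : ℝ} (ht : 0 < t) {v : ℝ → ℝ} (hv : Continuous v)
    {A : ℝ} (hA : ∀ y, |v y| ≤ A) (x : ℝ) :
    deriv (fun z => ∫ y, heatKernel t (z - y) * v y) x =
      ∫ y, heatKernelDeriv t (x - y) * v y := by
  have hA0 : 0 ≤ A := (abs_nonneg _).trans (hA 0)
  have hb : 0 < (4 * t)⁻¹ := by positivity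
  set b := (4 * t)⁻¹ with hb_def
  set c := (2 * t)⁻¹ * (Real.sqrt (4 * Real.pi * t))⁻¹ with hc_def
  have hc : 0 ≤ c := by positivity
  have hint : Integrable fun w : ℝ => (|w| + 1) * Real.exp (-(b / 2) * w ^ 2) := by
    simp only [add_mul, one_mul]
    refine Integrable.add ?_ (integrable_exp_neg_mul_sq (by positivity))
    refine (integrable_mul_exp_neg_mul_sq (b := b / 2) (by positivity)).abs.congr
      (.of_forall fun w => ?_)
    simp [abs_mul]
  refine (hasDerivAt_integral_of_dominated_loc_of_deriv_le
    (F' := fun z y => heatKernelDeriv t (z - y) * v y)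
    (bound := fun y => c * Real.exp b * A * ((|x - y| + 1) * Real.exp (-(b / 2) * (x - y) ^ 2)))
    (Metric.ball_mem_nhds x one_pos) ?_ ?_ ?_ ?_ ?_ ?_).2.deriv
  · exact .of_forall fun z => Continuous.aestronglyMeasurable
      (((continuous_heatKernel t).comp (by fun_prop)).mul hv)
  · exact ((integrable_heatKernel ht).comp_sub_left x).mul_bdd hv.aestronglyMeasurable
      (.of_forall hA)
  · exact (integrable_heatKernelDeriv_mul ht hv hA x).aestronglyMeasurable
  · refine .of_forall fun y z hz => ?_
    rw [Metric.mem_ball, Real.dist_eq] at hz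
    have h1 : |z - y| ≤ |x - y| + 1 := by
      have := abs_add_le (z - x) (x - y)
      rw [sub_add_sub_cancel] at this
      linarith
    have h2 : (x - y) ^ 2 ≤ 2 * (z - y) ^ 2 + 2 := by
      have : (z - x) ^ 2 ≤ 1 := by
        rw [sq_le_one_iff_abs_le_one]
        exact hz.le
      nlinarith [sq_nonneg ((z - y) + (z - x))]
    have h3 : Real.exp (-b * (z - y) ^ 2) ≤ Real.exp b * Real.exp (-(b / 2) * (x - y) ^ 2) := by
      rw [← Real.exp_add]
      gcongr
      nlinarith
    rw [Real.norm_eq_abs, abs_mul, abs_heatKernelDeriv ht]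
    calc c * (|z - y| * Real.exp (-b * (z - y) ^ 2)) * |v y|
        ≤ c * ((|x - y| + 1) * (Real.exp b * Real.exp (-(b / 2) * (x - y) ^ 2))) * A := by
          gcongr
          exact hA y
      _ = _ := by ring
  · exact (hint.comp_sub_left x).const_mul _
  · refine .of_forall fun y z _ => ?_
    have h := (hasDerivAt_heatKernel t (z - y)).comp z ((hasDerivAt_id z).sub_const y)
    rw [mul_one] at h
    exact h.mul_const (v y)

/-- The exponentially weighted singular kernel of the Grönwall argument, extended by zero. The rate
`4 * π` makes its total mass equal to `1 / 2`. -/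
noncomputable def singularKernel : ℝ → ℝ :=
  indicator (Ioi 0) fun r => r ^ (-(1 / 2) : ℝ) * Real.exp (-(4 * Real.pi * r))

theorem singularKernel_nonneg (r : ℝ) : 0 ≤ singularKernel r :=
  indicator_nonneg (fun r (hr : 0 < r) => by positivity) r

theorem integral_singularKernel : ∫ r, singularKernel r = 1 / 2 := by
  rw [singularKernel, integral_indicator measurableSet_Ioi]
  have h := Real.integral_rpow_mul_exp_neg_mul_Ioi (a := 1 / 2) (r := 4 * Real.pi)
    (by norm_num) (by positivity)
  rw [show (1 / 2 - 1 : ℝ) = -(1 / 2) by norm_num] at h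
  rw [h, Real.Gamma_one_half_eq, ← Real.sqrt_eq_rpow, ← Real.sqrt_mul (by positivity),
    show 1 / (4 * Real.pi) * Real.pi = (1 / 2) ^ 2 by field_simp; norm_num,
    Real.sqrt_sq (by norm_num)]

theorem integrable_singularKernel : Integrable singularKernel :=
  Integrable.of_integral_ne_zero (by rw [integral_singularKernel]; norm_num)

theorem exp_mul_rpow_eq_singularKernel {s t : ℝ} (hst : s < t) :
    Real.exp (4 * Real.pi * s) * (t - s) ^ (-(1 / 2) : ℝ) =
      Real.exp (4 * Real.pi * t) * singularKernel (t - s) := by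
  rw [singularKernel, indicator_of_mem (mem_Ioi.2 (sub_pos.2 hst)), mul_left_comm, ← Real.exp_add,
    mul_comm]
  congr 2
  ring

theorem integrable_singularKernel_comp_sub (t : ℝ) :
    IntegrableOn (fun s => singularKernel (t - s)) (Ioo 0 t) :=
  (integrable_singularKernel.comp_sub_left t).integrableOn

theorem integral_singularKernel_comp_sub_le (t : ℝ) :
    ∫ s in Ioo 0 t, singularKernel (t - s) ≤ 1 / 2 := by
  rw [← integral_singularKernel, ← integral_sub_left_eq_self singularKernel volume t]
  exact setIntegral_le_integral (integrable_singularKernel.comp_sub_left t)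
    (.of_forall fun s => singularKernel_nonneg _)

theorem integral_heatKernel_neg_of_odd (t x : ℝ) {v : ℝ → ℝ} (hv : ∀ y, v (-y) = -v y) :
    ∫ y, heatKernel t (-x - y) * v y = -∫ y, heatKernel t (x - y) * v y := by
  rw [← integral_neg_eq_self, ← integral_neg]
  congr with y
  rw [hv, ← heatKernel_neg]
  ring_nf

theorem integral_heatKernelDeriv_neg (t x : ℝ) (v : ℝ → ℝ) :
    ∫ y, heatKernelDeriv t (-x - y) * v y = -∫ y, heatKernelDeriv t (x - y) * v (-y) := by
  rw [← integral_neg_eq_self, ← integral_neg]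
  congr with y
  rw [show -x - -y = -(x - y) by ring, heatKernelDeriv_neg, neg_mul]

/-- The Duhamel integrand is integrable in time. -/
theorem integrableOn_duhamel {u : ℝ → ℝ → ℝ} (hcont : Continuous (Function.uncurry u))
    {t M : ℝ} (hM : ∀ s ∈ Ioo 0 t, ∀ x, |u s x| ≤ M) (x : ℝ) :
    IntegrableOn (fun s => ∫ y, heatKernelDeriv (t - s) (x - y) * |u s y|) (Ioo 0 t) := by
  refine ((integrable_singularKernel_comp_sub t).const_mul
    (M * Real.exp (4 * Real.pi * t))).mono' ?_ ?_
  · refine (StronglyMeasurable.integral_prod_right (f := fun s y =>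
      heatKernelDeriv (t - s) (x - y) * |u s y|)
      (Measurable.stronglyMeasurable ?_)).aestronglyMeasurable
    exact (measurable_heatKernelDeriv.comp
      (f := fun p : ℝ × ℝ => (t - p.1, x - p.2)) (by fun_prop)).mul hcont.abs.measurable
  · refine (ae_restrict_iff' measurableSet_Ioo).2 (.of_forall fun s hs => ?_)
    have hM0 : 0 ≤ M := (abs_nonneg _).trans (hM s hs 0)
    have hpos : 0 < t - s := sub_pos.2 hs.2
    refine (abs_integral_heatKernelDeriv_mul_le hpos (A := M) (fun y => ?_) x).trans ?_
    · rw [abs_abs]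
      exact hM s hs y
    · rw [mul_assoc, ← exp_mul_rpow_eq_singularKernel hs.2]
      gcongr
      refine le_mul_of_one_le_left (by positivity) (Real.one_le_exp ?_)
      have := hs.1
      positivity

/-- One step of the singular Grönwall iteration: an exponentially weighted bound on the even part
of a mild solution can be halved. -/
theorem abs_add_neg_le_half {u₀ : ℝ → ℝ} (hodd₀ : ∀ x : ℝ, u₀ (-x) = -u₀ x)
    {u : ℝ → ℝ → ℝ} (hcont : Continuous (Function.uncurry u))
    {t M : ℝ} (ht : 0 < t) (hM : ∀ s ∈ Ioo 0 t, ∀ x, |u s x| ≤ M)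
    (hmild : ∀ x : ℝ,
      u t x = (∫ y : ℝ, heatKernel t (x - y) * u₀ y) +
        ∫ s in Ioo (0 : ℝ) t,
          deriv (fun z => ∫ y : ℝ, heatKernel (t - s) (z - y) * |u s y|) x)
    {B : ℝ} (hB : ∀ s ∈ Ioo 0 t, ∀ x, |u s x + u s (-x)| ≤ B * Real.exp (4 * Real.pi * s))
    (x : ℝ) : |u t x + u t (-x)| ≤ B / 2 * Real.exp (4 * Real.pi * t) := by
  have hu (s : ℝ) : Continuous (u s) := hcont.comp (Continuous.prodMk_right s)
  have hderiv (z : ℝ) :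
      ∫ s in Ioo (0 : ℝ) t, deriv (fun z => ∫ y : ℝ, heatKernel (t - s) (z - y) * |u s y|) z =
        ∫ s in Ioo (0 : ℝ) t, ∫ y, heatKernelDeriv (t - s) (z - y) * |u s y| :=
    setIntegral_congr_fun measurableSet_Ioo fun s hs =>
      deriv_integral_heatKernel_mul (sub_pos.2 hs.2) (hu s).abs (A := M)
        (fun y => (abs_abs _).trans_le (hM s hs y)) z
  have hsum : u t x + u t (-x) = ∫ s in Ioo (0 : ℝ) t,
      ((∫ y, heatKernelDeriv (t - s) (x - y) * |u s y|) +
        ∫ y, heatKernelDeriv (t - s) (-x - y) * |u s y|) := by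
    rw [integral_add (integrableOn_duhamel hcont hM x) (integrableOn_duhamel hcont hM (-x)),
      hmild x, hmild (-x), hderiv, hderiv, integral_heatKernel_neg_of_odd t x hodd₀]
    ring
  have hB0 : 0 ≤ B := by
    have hmem : t / 2 ∈ Ioo 0 t := ⟨half_pos ht, half_lt_self ht⟩
    exact nonneg_of_mul_nonneg_left ((abs_nonneg _).trans (hB _ hmem 0)) (Real.exp_pos _)
  rw [hsum, ← Real.norm_eq_abs]
  calc _ ≤ ∫ s in Ioo (0 : ℝ) t, B * Real.exp (4 * Real.pi * t) * singularKernel (t - s) := by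
        refine norm_integral_le_of_norm_le ((integrable_singularKernel_comp_sub t).const_mul _)
          ((ae_restrict_iff' measurableSet_Ioo).2 (.of_forall fun s hs => ?_))
        have hpos : 0 < t - s := sub_pos.2 hs.2
        rw [Real.norm_eq_abs, integral_heatKernelDeriv_neg, ← sub_eq_add_neg, ← integral_sub
          (integrable_heatKernelDeriv_mul hpos (hu s).abs
            (fun y => (abs_abs _).trans_le (hM s hs y)) x)
          (integrable_heatKernelDeriv_mul (v := fun y => |u s (-y)|) hpos
            ((hu s).comp continuous_neg).abs
            (fun y => (abs_abs _).trans_le (hM s hs (-y))) x)]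
        simp only [← mul_sub]
        rw [mul_assoc, ← exp_mul_rpow_eq_singularKernel hs.2, ← mul_assoc]
        refine abs_integral_heatKernelDeriv_mul_le hpos (fun y => ?_) x
        refine le_trans ?_ (hB s hs y)
        simpa using abs_abs_sub_abs_le (u s y) (-u s (-y))
    _ ≤ B * Real.exp (4 * Real.pi * t) * (1 / 2) := by
        rw [integral_const_mul]
        gcongr
        exact integral_singularKernel_comp_sub_le t
    _ = _ := by ring

/-- Odd parity is preserved by mild solutions of the modular Burgers' equation
`u_t = u_xx + |u|_x`. -/
theorem stmt_9 (u₀ : ℝ → ℝ)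
    (hbdd₀ : ∃ M : ℝ, ∀ x, |u₀ x| ≤ M)
    (huc₀ : UniformContinuous u₀)
    (hodd₀ : ∀ x : ℝ, u₀ (-x) = -u₀ x)
    (u : ℝ → ℝ → ℝ)
    (hcont : Continuous (Function.uncurry u))
    (hbdd : ∀ T : ℝ, 0 < T → ∃ M : ℝ, ∀ t ∈ Icc (0:ℝ) T, ∀ x : ℝ, |u t x| ≤ M)
    (hinit : ∀ x : ℝ, u 0 x = u₀ x)
    (hmild : ∀ t : ℝ, 0 < t → ∀ x : ℝ,
      u t x = (∫ y : ℝ, heatKernel t (x - y) * u₀ y) +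
        ∫ s in Ioo (0:ℝ) t,
          deriv (fun z => ∫ y : ℝ, heatKernel (t - s) (z - y) * |u s y|) x) :
    ∀ t : ℝ, 0 ≤ t → ∀ x : ℝ, u t (-x) = -u t x := by
  have hzero (x : ℝ) : u 0 x + u 0 (-x) = 0 := by rw [hinit, hinit, hodd₀, add_neg_cancel]
  intro t ht x
  rcases ht.eq_or_lt with rfl | ht
  · linarith [hzero x]
  obtain ⟨M, hM⟩ := hbdd t ht
  have hM0 : 0 ≤ M := (abs_nonneg _).trans (hM t ⟨ht.le, le_rfl⟩ 0)
  have hiter (n : ℕ) : ∀ s ∈ Icc 0 t, ∀ x,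
      |u s x + u s (-x)| ≤ 2 * M * (1 / 2) ^ n * Real.exp (4 * Real.pi * s) := by
    induction n with
    | zero =>
      intro s hs x
      have h1 : |u s x + u s (-x)| ≤ 2 * M :=
        (abs_add_le _ _).trans (by linarith [hM s hs x, hM s hs (-x)])
      have h2 : 1 ≤ Real.exp (4 * Real.pi * s) :=
        Real.one_le_exp (mul_nonneg (by positivity) hs.1)
      rw [pow_zero, mul_one]
      exact h1.trans (le_mul_of_one_le_right (by positivity) h2)
    | succ n ih =>
      intro s hs x
      rcases hs.1.eq_or_lt with rfl | hs0
      · rw [hzero, abs_zero]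
        positivity
      have hsub : ∀ r ∈ Ioo 0 s, r ∈ Icc 0 t := fun r hr => ⟨hr.1.le, hr.2.le.trans hs.2⟩
      refine (abs_add_neg_le_half hodd₀ hcont hs0 (fun r hr => hM r (hsub r hr)) (hmild s hs0)
        (fun r hr => ih r (hsub r hr)) x).trans_eq ?_
      ring
  have hlim : Filter.Tendsto
      (fun n : ℕ => 2 * M * (1 / 2 : ℝ) ^ n * Real.exp (4 * Real.pi * t))
      Filter.atTop (nhds 0) := by
    simpa using ((tendsto_pow_atTop_nhds_zero_of_lt_one (r := (1 / 2 : ℝ)) (by norm_num)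
      (by norm_num)).const_mul (2 * M)).mul_const (Real.exp (4 * Real.pi * t))
  have h0 := ge_of_tendsto' hlim fun n => hiter n t ⟨ht.le, le_rfl⟩ x
  linarith [abs_nonpos_iff.1 h0]
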